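/- Let A be a finite nonempty set with the discrete topology, let Ω = A^ℤ carry the product topology metrized by D(x,y) = sup_{j∈ℤ} 2^{−|j|}·ρ(x_j,y_j) where ρ is the discrete metric on A, and let σ : Ω → Ω be the shift σ((x_n)_{n∈ℤ}) = (x_{n+1})_{n∈ℤ}. Let X ⊆ Ω be a nonempty closed σ-invariant subset (a shift space) and consider σ restricted to X. Then X is a topologically mixing shift of finite type if and only if σ|X has the two-sided limit shadowing property. -/

import Mathlib

open Filter Topology

/-- The shift map on `A^ℤ`, as a bijection. -/
def shiftMap {A : Type*} : (ℤ → A) ≃ (ℤ → A) where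
  toFun x n := x (n + 1)
  invFun x n := x (n - 1)
  left_inv x := funext fun n => by simp
  right_inv x := funext fun n => by simp

/-- The metric `D(x,y) = sup_j 2^{-|j|} ρ(x_j, y_j)`, where `ρ` is the discrete
metric on `A`. -/
noncomputable def shiftDist {A : Type*} [DecidableEq A] (x y : ℤ → A) : ℝ :=
  ⨆ j : ℤ, (2 : ℝ) ^ (-|j|) * (if x j = y j then 0 else 1)

/-- `X` is a shift of finite type: membership in `X` is determined by a set `𝓛` of
admissible words of length `N + 1`. -/
def IsShiftOfFiniteType {A : Type*} (X : Set (ℤ → A)) : Prop :=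
  ∃ N : ℕ, ∃ 𝓛 : Set (Fin (N + 1) → A),
    ∀ x : ℤ → A, x ∈ X ↔ ∀ j : ℤ, (fun k : Fin (N + 1) => x (j + (k : ℕ))) ∈ 𝓛

/-- The restriction of the shift to `X` is topologically mixing (open sets of the
subspace `X` are realized as intersections of ambient open sets with `X`). -/
def ShiftMixingOn {A : Type*} [TopologicalSpace A] (X : Set (ℤ → A)) : Prop :=
  ∀ U V : Set (ℤ → A), IsOpen U → IsOpen V →
    (U ∩ X).Nonempty → (V ∩ X).Nonempty →
    ∃ N : ℕ, ∀ n : ℕ, N ≤ n → ((⇑(shiftMap ^ n) '' (U ∩ X)) ∩ (V ∩ X)).Nonempty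

/-- The restriction of the shift to `X` has the two-sided limit shadowing property
with respect to the metric `shiftDist`. -/
def ShiftTwoSidedLimitShadowingOn {A : Type*} [DecidableEq A]
    (X : Set (ℤ → A)) : Prop :=
  ∀ x : ℤ → (ℤ → A), (∀ i : ℤ, x i ∈ X) →
    Tendsto (fun i : ℤ => shiftDist (shiftMap (x i)) (x (i + 1))) cofinite (𝓝 0) →
    ∃ y ∈ X, Tendsto (fun i : ℤ => shiftDist ((shiftMap ^ i) y) (x i)) cofinite (𝓝 0)

theorem shiftMap_zpow_apply {A : Type*} (n : ℤ) (x : ℤ → A) (k : ℤ) :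
    (shiftMap ^ n : Equiv.Perm (ℤ → A)) x k = x (k + n) := by
  induction n generalizing x k with
  | zero => simp
  | succ n ih =>
    rw [zpow_add_one, Equiv.Perm.mul_apply, ih]
    simp only [shiftMap, Equiv.coe_fn_mk]
    congr 1
    ring
  | pred n ih =>
    rw [zpow_sub_one, Equiv.Perm.mul_apply, ih, Equiv.Perm.inv_def]
    simp only [shiftMap, Equiv.coe_fn_symm_mk]
    congr 1
    ring

theorem shiftMap_pow_apply {A : Type*} (n : ℕ) (x : ℤ → A) (k : ℤ) :
    (shiftMap ^ n : Equiv.Perm (ℤ → A)) x k = x (k + n) := by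
  simpa using shiftMap_zpow_apply (n : ℤ) x k

theorem translate_mem {A : Type*} {X : Set (ℤ → A)} (hinv : ⇑shiftMap '' X = X) {x : ℤ → A}
    (hx : x ∈ X) (n : ℤ) : (fun k => x (k + n)) ∈ X := by
  induction n with
  | zero => simpa using hx
  | succ n ih =>
    rw [← hinv]
    exact ⟨_, ih, funext fun k => by simp only [shiftMap, Equiv.coe_fn_mk]; congr 1; ring⟩
  | pred n ih =>
    rw [← hinv] at ih
    obtain ⟨y, hy, h⟩ := ih
    convert hy using 1
    funext k
    have := congrFun h (k - 1)
    simp only [shiftMap, Equiv.coe_fn_mk, sub_add_cancel] at this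
    rw [this]
    congr 1
    ring

theorem Int.eventually_cofinite_iff {P : ℤ → Prop} :
    (∀ᶠ i in cofinite, P i) ↔ ∃ B : ℕ, ∀ i : ℤ, (i ≤ -B ∨ B ≤ i) → P i := by
  rw [Int.cofinite_eq, eventually_sup, eventually_atBot, eventually_atTop]
  constructor
  · rintro ⟨⟨a, ha⟩, b, hb⟩
    refine ⟨a.natAbs + b.natAbs, fun i hi => ?_⟩
    rcases hi with hi | hi
    · exact ha i (by omega)
    · exact hb i (by omega)
  · rintro ⟨B, hB⟩
    exact ⟨⟨-B, fun i hi => hB i (.inl hi)⟩, B, fun i hi => hB i (.inr hi)⟩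

section Distance

variable {A : Type*} [DecidableEq A]

theorem shiftDist_term_le_one (x y : ℤ → A) (j : ℤ) :
    (2 : ℝ) ^ (-|j|) * (if x j = y j then 0 else 1) ≤ 1 := by
  have : (2 : ℝ) ^ (-|j|) ≤ 1 := zpow_le_one_of_nonpos₀ (by norm_num) (by simp)
  split_ifs <;> linarith

theorem shiftDist_nonneg (x y : ℤ → A) : 0 ≤ shiftDist x y :=
  Real.iSup_nonneg fun j => by split_ifs <;> positivity

theorem eq_of_shiftDist_lt {x y : ℤ → A} {M : ℕ} (h : shiftDist x y < (2 : ℝ) ^ (-(M : ℤ)))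
    {k : ℤ} (h₁ : -M ≤ k) (h₂ : k ≤ M) : x k = y k := by
  by_contra hne
  have hle : (2 : ℝ) ^ (-|k|) * (if x k = y k then 0 else 1) ≤ shiftDist x y :=
    le_ciSup (f := fun j : ℤ => (2 : ℝ) ^ (-|j|) * (if x j = y j then 0 else 1))
      ⟨1, by rintro _ ⟨j, rfl⟩; exact shiftDist_term_le_one x y j⟩ k
  rw [if_neg hne, mul_one] at hle
  have : (2 : ℝ) ^ (-(M : ℤ)) ≤ (2 : ℝ) ^ (-|k|) :=
    zpow_le_zpow_right₀ (by norm_num) (neg_le_neg (abs_le.2 ⟨h₁, h₂⟩))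
  linarith

theorem shiftDist_le {x y : ℤ → A} {M : ℕ} (h : ∀ k : ℤ, -M ≤ k → k ≤ M → x k = y k) :
    shiftDist x y ≤ (2 : ℝ) ^ (-(M : ℤ)) := by
  refine ciSup_le fun j => ?_
  split_ifs with hj
  · simp only [mul_zero]; positivity
  · rw [mul_one]
    refine zpow_le_zpow_right₀ (by norm_num) (neg_le_neg ?_)
    by_contra hlt
    exact hj (h j (abs_le.1 (not_le.1 hlt).le).1 (abs_le.1 (not_le.1 hlt).le).2)

theorem tendsto_shiftDist_iff {ι : Type*} {l : Filter ι} {f g : ι → ℤ → A} :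
    Tendsto (fun i => shiftDist (f i) (g i)) l (𝓝 0) ↔
      ∀ M : ℕ, ∀ᶠ i in l, ∀ k : ℤ, -M ≤ k → k ≤ M → f i k = g i k := by
  constructor
  · intro h M
    have hpos : (0 : ℝ) < (2 : ℝ) ^ (-(M : ℤ)) := by positivity
    filter_upwards [h.eventually_lt_const hpos] with i hi k h₁ h₂
    exact eq_of_shiftDist_lt hi h₁ h₂
  · intro h
    refine Metric.tendsto_nhds.2 fun ε hε => ?_
    obtain ⟨M, hM⟩ := exists_pow_lt_of_lt_one hε (by norm_num : (2 : ℝ)⁻¹ < 1)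
    filter_upwards [h M] with i hi
    rw [Real.dist_0_eq_abs, abs_of_nonneg (shiftDist_nonneg _ _)]
    refine (shiftDist_le hi).trans_lt ?_
    rwa [zpow_neg, zpow_natCast, ← inv_pow]

end Distance

section Topology

variable {A : Type*} [TopologicalSpace A]

theorem eventually_nhds_agree [DiscreteTopology A] (x : ℤ → A) (M : ℕ) :
    ∀ᶠ y in 𝓝 x, ∀ k : ℤ, -M ≤ k → k ≤ M → y k = x k := by
  have : ∀ᶠ y in 𝓝 x, ∀ k ∈ Finset.Icc (-M : ℤ) M, y k = x k :=
    (eventually_all_finset _).2 fun k _ =>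
      ((isOpen_discrete {x k}).preimage (continuous_apply k)).mem_nhds
        (show x ∈ (fun p : ℤ → A => p k) ⁻¹' {x k} from rfl)
  filter_upwards [this] with y hy k h₁ h₂
  exact hy k (Finset.mem_Icc.2 ⟨h₁, h₂⟩)

theorem IsOpen.exists_agree_subset {U : Set (ℤ → A)} (hU : IsOpen U) {x : ℤ → A} (hx : x ∈ U) :
    ∃ M : ℕ, ∀ y : ℤ → A, (∀ k : ℤ, -M ≤ k → k ≤ M → y k = x k) → y ∈ U := by
  obtain ⟨I, u, hu, hsub⟩ := isOpen_pi_iff.1 hU x hx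
  refine ⟨I.sup Int.natAbs, fun y hy => hsub fun k hk => ?_⟩
  have : k.natAbs ≤ I.sup Int.natAbs := Finset.le_sup (f := Int.natAbs) hk
  rw [hy k (by omega) (by omega)]
  exact (hu k hk).2

theorem IsCompact.exists_frequently_agree [DiscreteTopology A] {X : Set (ℤ → A)} (hX : IsCompact X)
    {f : ℕ → ℤ → A} (hf : ∀ j, f j ∈ X) :
    ∃ u ∈ X, ∀ M B : ℕ, ∃ j ≥ B, ∀ k : ℤ, -M ≤ k → k ≤ M → f j k = u k := by
  obtain ⟨u, hu, hc⟩ := hX.exists_mapClusterPt (f := atTop) (u := f)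
    (tendsto_principal.2 (Eventually.of_forall hf))
  exact ⟨u, hu, fun M => frequently_atTop.1 (hc.frequently (eventually_nhds_agree u M))⟩

end Topology

/-- Away from finitely many times, an entry of a limit pseudo-orbit agrees near the origin with the
sequence of central letters of the pseudo-orbit. -/
theorem eventually_agree_central_letters {A : Type*} {x : ℤ → ℤ → A}
    (h : ∀ M : ℕ, ∀ᶠ i in cofinite, ∀ k : ℤ, -M ≤ k → k ≤ M → x i (k + 1) = x (i + 1) k) (M : ℕ) :
    ∀ᶠ i in cofinite, ∀ k : ℤ, -M ≤ k → k ≤ M → x i k = x (i + k) 0 := by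
  obtain ⟨B, hB⟩ := Int.eventually_cofinite_iff.1 (h M)
  have right : ∀ (i k : ℤ) (l : ℕ), (i ≤ -(B + M) ∨ B + M ≤ i) → l ≤ k → k ≤ M →
      x i k = x (i + l) (k - l) := by
    intro i k l hi hl hk
    induction l with
    | zero => simp
    | succ l ih =>
      have := hB (i + l) (by omega) (k - l - 1) (by omega) (by omega)
      rw [sub_add_cancel] at this
      rw [ih (by omega), this]
      congr 1 <;> push_cast <;> ring_nf
  have left : ∀ (i k : ℤ) (l : ℕ), (i ≤ -(B + M) ∨ B + M ≤ i) → k ≤ -l → -M ≤ k →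
      x i k = x (i - l) (k + l) := by
    intro i k l hi hl hk
    induction l with
    | zero => simp
    | succ l ih =>
      have := hB (i - l - 1) (by omega) (k + l) (by omega) (by omega)
      rw [sub_add_cancel] at this
      rw [ih (by omega), ← this]
      congr 1 <;> push_cast <;> ring_nf
  refine Int.eventually_cofinite_iff.2 ⟨B + M, fun i hi k h₁ h₂ => ?_⟩
  push_cast at hi
  obtain ⟨l, rfl | rfl⟩ := k.eq_nat_or_neg
  · simpa using right i l l hi le_rfl h₂
  · simpa [sub_eq_add_neg] using left i (-l) l hi le_rfl h₁

theorem ShiftMixingOn.exists_uniform_gap {A : Type*} [Finite A] [TopologicalSpace A]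
    [DiscreteTopology A] {X : Set (ℤ → A)} (hmix : ShiftMixingOn X) (N : ℕ) :
    ∃ L : ℕ, ∀ n ≥ L, ∀ x ∈ X, ∀ y ∈ X, ∃ z ∈ X, ∀ k : ℤ, 0 ≤ k → k ≤ N →
      z k = x k ∧ z (k + n) = y k := by
  have := Fintype.ofFinite A
  let C : (Fin (N + 1) → A) → Set (ℤ → A) := fun w => {x | ∀ k : Fin (N + 1), x (k : ℕ) = w k}
  have hC : ∀ w, IsOpen (C w) := fun w => by
    simp only [C, Set.ofPred_forall]
    exact isOpen_iInter_of_finite fun k =>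
      (isOpen_discrete {w k}).preimage (continuous_apply (A := fun _ => A) ((k : ℕ) : ℤ))
  have hL : ∀ p : (Fin (N + 1) → A) × (Fin (N + 1) → A), ∃ L : ℕ, ∀ n ≥ L,
      (C p.1 ∩ X).Nonempty → (C p.2 ∩ X).Nonempty →
      ((⇑(shiftMap ^ n) '' (C p.1 ∩ X)) ∩ (C p.2 ∩ X)).Nonempty := by
    intro p
    by_cases h₁ : (C p.1 ∩ X).Nonempty
    · by_cases h₂ : (C p.2 ∩ X).Nonempty
      · obtain ⟨L, hL⟩ := hmix _ _ (hC p.1) (hC p.2) h₁ h₂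
        exact ⟨L, fun n hn _ _ => hL n hn⟩
      · exact ⟨0, fun n _ _ h => absurd h h₂⟩
    · exact ⟨0, fun n _ h _ => absurd h h₁⟩
  choose L hL using hL
  refine ⟨Finset.univ.sup L, fun n hn x hx y hy => ?_⟩
  obtain ⟨_, ⟨z, ⟨hz₁, hzX⟩, rfl⟩, hz₂, -⟩ :=
    hL (fun k => x (k : ℕ), fun k => y (k : ℕ)) n ((Finset.le_sup (Finset.mem_univ _)).trans hn)
      ⟨x, fun _ => rfl, hx⟩ ⟨y, fun _ => rfl, hy⟩
  refine ⟨z, hzX, fun k h₀ hk => ?_⟩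
  lift k to ℕ using h₀
  have h₁ := hz₁ ⟨k, by omega⟩
  have h₂ := hz₂ ⟨k, by omega⟩
  rw [shiftMap_pow_apply] at h₂
  exact ⟨h₁, h₂⟩

theorem IsShiftOfFiniteType.exists_mem_of_agree {A : Type*} {X : Set (ℤ → A)}
    (h : IsShiftOfFiniteType X) :
    ∃ N : ℕ, ∀ x : ℤ → A,
      (∀ j : ℤ, ∃ p ∈ X, ∃ l : ℤ, ∀ k : ℤ, 0 ≤ k → k ≤ N → x (j + k) = p (l + k)) → x ∈ X := by
  obtain ⟨N, 𝓛, hX⟩ := h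
  refine ⟨N, fun x hx => (hX x).2 fun j => ?_⟩
  obtain ⟨p, hp, l, hl⟩ := hx j
  convert (hX p).1 hp l using 1
  funext k
  exact hl k (by omega) (by omega)

theorem IsShiftOfFiniteType.twoSidedLimitShadowing {A : Type*} [Finite A] [DecidableEq A]
    [TopologicalSpace A] [DiscreteTopology A] {X : Set (ℤ → A)}
    (hX : IsShiftOfFiniteType X) (hmix : ShiftMixingOn X) : ShiftTwoSidedLimitShadowingOn X := by
  intro x hx hpo
  have hagree := eventually_agree_central_letters (x := x) fun M => by
    simpa [shiftMap] using tendsto_shiftDist_iff.1 hpo M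
  obtain ⟨N, hN⟩ := hX.exists_mem_of_agree
  obtain ⟨B, hB⟩ := Int.eventually_cofinite_iff.1 (hagree N)
  obtain ⟨L, hL⟩ := hmix.exists_uniform_gap N
  obtain ⟨z, hz, hzx⟩ := hL (B + L + B + N) (by omega) _ (hx (-(B + N))) _ (hx (B + L))
  have hz₁ : ∀ k : ℤ, 0 ≤ k → k ≤ N → z k = x (-(B + N) + k) 0 := fun k h₀ hk => by
    rw [(hzx k h₀ hk).1, hB _ (.inl (by omega)) _ (by omega) hk]
  have hz₂ : ∀ k : ℤ, 0 ≤ k → k ≤ N → z (k + (B + L + B + N)) = x (B + L + k) 0 :=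
    fun k h₀ hk => by
      rw [← hB _ (.inr (by omega)) _ (by omega) hk, ← (hzx k h₀ hk).2]
      push_cast
      rfl
  let y : ℤ → A := fun i => if i < -B then x i 0 else if i < B + L then z (i + (B + N)) else x i 0
  have hyx : ∀ i : ℤ, (i ≤ -B ∨ (B + L) ≤ i) → y i = x i 0 := by
    intro i hi
    simp only [y]
    split_ifs with h₁ h₂
    · rfl
    · rw [hz₁ _ (by omega) (by omega)]
      ring_nf
    · rfl
  have hyz : ∀ i : ℤ, -(B + N) ≤ i → i ≤ B + L + N → y i = z (i + (B + N)) := by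
    intro i h₁ h₂
    simp only [y]
    split_ifs with h₃ h₄
    · rw [hz₁ _ (by omega) (by omega)]
      ring_nf
    · rfl
    · have := hz₂ (i - (B + L)) (by omega) (by omega)
      rw [add_sub_cancel] at this
      rw [← this]
      ring_nf
  refine ⟨y, hN y fun j => ?_, tendsto_shiftDist_iff.2 fun M => ?_⟩
  · by_cases h₁ : j < -(B + N)
    · refine ⟨x j, hx j, 0, fun k hk₀ hk => ?_⟩
      rw [hyx _ (.inl (by omega)), zero_add, hB j (.inl (by omega)) k (by omega) hk]
    · by_cases h₂ : B + L < j
      · refine ⟨x j, hx j, 0, fun k hk₀ hk => ?_⟩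
        rw [hyx _ (.inr (by omega)), zero_add, hB j (.inr (by omega)) k (by omega) hk]
      · refine ⟨z, hz, j + (B + N), fun k hk₀ hk => ?_⟩
        rw [hyz _ (by omega) (by omega)]
        congr 1
        ring
  · filter_upwards [hagree M, Int.eventually_cofinite_iff.2 ⟨B + L + M, fun _ => id⟩]
      with i hi hiM k h₁ h₂
    rw [shiftMap_zpow_apply, hi k h₁ h₂, add_comm k i, hyx]
    push_cast at hiM
    omega

/-- The windows of length `N + 1` of the word `w` at the positions `0, …, n` occur in `X`. -/
def HasWindowsIn {A : Type*} (X : Set (ℤ → A)) (N n : ℕ) (w : ℕ → A) : Prop :=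
  ∀ i ≤ n, ∃ p ∈ X, ∀ k : ℕ, k ≤ N → p k = w (i + k)

/-- There is a word whose windows of length `N + 1` occur in `X`, which starts like `x` and looks
like `y` from position `n` on. -/
def ChainReaches {A : Type*} (X : Set (ℤ → A)) (N n : ℕ) (x y : ℤ → A) : Prop :=
  ∃ w : ℕ → A, HasWindowsIn X N n w ∧ (∀ k ≤ N, w k = x k) ∧ ∀ k ≤ N, w (n + k) = y k

section Chains

variable {A : Type*} {X : Set (ℤ → A)} {N : ℕ}

theorem HasWindowsIn.glue {n m : ℕ} {v w : ℕ → A} (hv : HasWindowsIn X N n v)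
    (hw : HasWindowsIn X N m w) (h : ∀ k ≤ N, v (n + k) = w k) :
    ∃ u, HasWindowsIn X N (n + m) u ∧ (∀ k ≤ n + N, u k = v k) ∧ ∀ k, u (n + k) = w k := by
  let u : ℕ → A := fun i => if i < n then v i else w (i - n)
  have hu₁ : ∀ k ≤ n + N, u k = v k := by
    intro k hk
    simp only [u]
    split_ifs with hn
    · rfl
    · rw [← h _ (by omega)]
      congr 1
      omega
  have hu₂ : ∀ k, u (n + k) = w k := by simp [u]
  refine ⟨u, fun i hi => ?_, hu₁, hu₂⟩
  by_cases hn : i ≤ n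
  · obtain ⟨p, hp, hpv⟩ := hv i hn
    exact ⟨p, hp, fun k hk => by rw [hpv k hk, hu₁ _ (by omega)]⟩
  · obtain ⟨p, hp, hpw⟩ := hw (i - n) (by omega)
    refine ⟨p, hp, fun k hk => ?_⟩
    rw [hpw k hk, ← hu₂]
    congr 1
    omega

theorem ChainReaches.trans {n m : ℕ} {x y z : ℤ → A} (h₁ : ChainReaches X N n x y)
    (h₂ : ChainReaches X N m y z) : ChainReaches X N (n + m) x z := by
  obtain ⟨v, hv, hvx, hvy⟩ := h₁
  obtain ⟨w, hw, hwy, hwz⟩ := h₂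
  obtain ⟨u, hu, huv, huw⟩ := hv.glue hw fun k hk => by rw [hvy k hk, hwy k hk]
  exact ⟨u, hu, fun k hk => by rw [huv k (by omega), hvx k hk],
    fun k hk => by rw [add_assoc, huw, hwz k hk]⟩

theorem ChainReaches.congr {n : ℕ} {x x' y y' : ℤ → A} (h : ChainReaches X N n x y)
    (hx : ∀ k : ℕ, k ≤ N → x k = x' k) (hy : ∀ k : ℕ, k ≤ N → y k = y' k) :
    ChainReaches X N n x' y' := by
  obtain ⟨w, hw, hwx, hwy⟩ := h
  exact ⟨w, hw, fun k hk => by rw [hwx k hk, hx k hk], fun k hk => by rw [hwy k hk, hy k hk]⟩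

/-- Chains along the orbit of a point of `X`. -/
theorem ChainReaches.of_mem (hinv : ⇑shiftMap '' X = X) {x : ℤ → A} (hx : x ∈ X) (N : ℕ)
    (a : ℤ) (n : ℕ) :
    ChainReaches X N n (fun k => x (k + a)) (fun k => x (k + (a + n))) := by
  refine ⟨fun i => x (i + a), fun i _ => ⟨_, translate_mem hinv hx (a + i), fun k _ => ?_⟩,
    fun k _ => rfl, fun k _ => ?_⟩
  · push_cast; ring_nf
  · push_cast; ring_nf

theorem ChainReaches.mul {c : ℕ} {x : ℤ → A} (h : ChainReaches X N c x x)
    (h₀ : ChainReaches X N 0 x x) (q : ℕ) : ChainReaches X N (q * c) x x := by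
  induction q with
  | zero => simpa using h₀
  | succ q ih => rw [add_one_mul]; exact ih.trans h

/-- Loops of consecutive lengths `c` and `c + 1` yield loops of all large lengths. -/
theorem ChainReaches.eventually_loop {c : ℕ} {x : ℤ → A} (h₀ : ChainReaches X N 0 x x)
    (h₁ : ChainReaches X N c x x) (h₂ : ChainReaches X N (c + 1) x x) :
    ∀ n ≥ c * c, ChainReaches X N n x x := by
  intro n hn
  rcases c.eq_zero_or_pos with rfl | hc
  · simpa using h₂.mul h₀ n
  · have hr := Nat.mod_lt n hc
    have hq : c ≤ n / c := (Nat.le_div_iff_mul_le hc).2 hn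
    convert (h₁.mul h₀ (n / c - n % c)).trans (h₂.mul h₀ (n % c)) using 1
    obtain ⟨d, hd⟩ := Nat.exists_eq_add_of_le (hr.le.trans hq)
    rw [hd, Nat.add_sub_cancel_left]
    have := Nat.div_add_mod n c
    rw [hd] at this
    nlinarith

end Chains

section LimitShadowing

variable {A : Type*} [DecidableEq A] {X : Set (ℤ → A)}

/-- A sequence whose windows of growing length occur in `X` near infinity agrees with a point of
`X` at all but finitely many places. -/
theorem ShiftTwoSidedLimitShadowingOn.exists_eventually_eq (h : ShiftTwoSidedLimitShadowingOn X)
    (hne : X.Nonempty) {w : ℤ → A}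
    (hw : ∀ M : ℕ, ∀ᶠ i in cofinite, ∃ p ∈ X, ∀ k : ℤ, -M ≤ k → k ≤ M → p k = w (i + k)) :
    ∃ y ∈ X, ∀ᶠ i in cofinite, y i = w i := by
  have best : ∀ (i : ℤ) (B : ℕ), ∃ p ∈ X, ∀ M ≤ B,
      (∃ q ∈ X, ∀ k : ℤ, -M ≤ k → k ≤ M → q k = w (i + k)) →
      ∀ k : ℤ, -M ≤ k → k ≤ M → p k = w (i + k) := by
    intro i B
    by_cases hB : ∃ q ∈ X, ∀ k : ℤ, -B ≤ k → k ≤ B → q k = w (i + k)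
    · obtain ⟨q, hq, hqw⟩ := hB
      exact ⟨q, hq, fun M hM _ k h₁ h₂ => hqw k (by omega) (by omega)⟩
    · induction B with
      | zero =>
        obtain ⟨p, hp⟩ := hne
        refine ⟨p, hp, fun M hM hM' => absurd hM' ?_⟩
        rwa [Nat.le_zero.1 hM]
      | succ B ih =>
        by_cases hB' : ∃ q ∈ X, ∀ k : ℤ, -B ≤ k → k ≤ B → q k = w (i + k)
        · obtain ⟨q, hq, hqw⟩ := hB'
          refine ⟨q, hq, fun M hM hM' k h₁ h₂ => ?_⟩
          rcases hM.lt_or_eq with hlt | rfl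
          · exact hqw k (by omega) (by omega)
          · exact absurd hM' hB
        · obtain ⟨q, hq, hqw⟩ := ih hB'
          refine ⟨q, hq, fun M hM hM' => ?_⟩
          rcases hM.lt_or_eq with hlt | rfl
          · exact hqw M (by omega) hM'
          · exact absurd hM' hB
  choose x hx hxw using fun i : ℤ => best i i.natAbs
  have hagree : ∀ M : ℕ, ∀ᶠ i in cofinite, ∀ k : ℤ, -M ≤ k → k ≤ M → x i k = w (i + k) := by
    intro M
    filter_upwards [hw M, Int.eventually_cofinite_iff.2 ⟨M, fun _ => id⟩] with i hi hiM
    exact hxw i M (by omega) hi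
  obtain ⟨y, hy, hyx⟩ := h x hx <| tendsto_shiftDist_iff.2 fun M => by
    obtain ⟨B, hB⟩ := Int.eventually_cofinite_iff.1 (hagree (M + 1))
    refine Int.eventually_cofinite_iff.2 ⟨B + 1, fun i hi k h₁ h₂ => ?_⟩
    simp only [shiftMap, Equiv.coe_fn_mk]
    rw [hB i (by omega) _ (by omega) (by omega), hB (i + 1) (by omega) _ (by omega) (by omega)]
    ring_nf
  refine ⟨y, hy, ?_⟩
  filter_upwards [tendsto_shiftDist_iff.1 hyx 0, hagree 0] with i h₁ h₂
  simpa [shiftMap_zpow_apply] using (h₁ 0 (by simp) (by simp)).trans (h₂ 0 (by simp) (by simp))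

/-- Under two-sided limit shadowing, any past can be joined to any future. -/
theorem ShiftTwoSidedLimitShadowingOn.exists_join (h : ShiftTwoSidedLimitShadowingOn X)
    (hinv : ⇑shiftMap '' X = X) {u v : ℤ → A} (hu : u ∈ X) (hv : v ∈ X) :
    ∃ z ∈ X, ∃ B : ℕ, (∀ i : ℤ, i ≤ -B → z i = u i) ∧ ∀ i : ℤ, B ≤ i → z i = v i := by
  obtain ⟨z, hz, hzw⟩ := h.exists_eventually_eq ⟨u, hu⟩
    (w := fun i => if i < 0 then u i else v i) fun M => by
      refine Int.eventually_cofinite_iff.2 ⟨M + 1, fun i hi => ?_⟩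
      rcases hi with hi | hi
      · refine ⟨_, translate_mem hinv hu i, fun k h₁ h₂ => ?_⟩
        rw [if_pos (by omega), add_comm]
      · refine ⟨_, translate_mem hinv hv i, fun k h₁ h₂ => ?_⟩
        rw [if_neg (by omega), add_comm]
  obtain ⟨B, hB⟩ := Int.eventually_cofinite_iff.1 hzw
  refine ⟨z, hz, B + 1, fun i hi => ?_, fun i hi => ?_⟩
  · rw [hB i (by omega), if_pos (by omega)]
  · rw [hB i (by omega), if_neg (by omega)]

/-- Two-sided limit shadowing forces chain transitivity. -/
theorem ShiftTwoSidedLimitShadowingOn.exists_chainReaches [TopologicalSpace A]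
    [DiscreteTopology A] (h : ShiftTwoSidedLimitShadowingOn X) (hinv : ⇑shiftMap '' X = X)
    (hX : IsCompact X) (N : ℕ) {x y : ℤ → A} (hx : x ∈ X) (hy : y ∈ X) :
    ∃ n ≥ 1, ChainReaches X N n x y := by
  obtain ⟨u, hu, hux⟩ := hX.exists_frequently_agree
    (f := fun j k => x (k + j)) fun j => translate_mem hinv hx j
  obtain ⟨v, hv, hvy⟩ := hX.exists_frequently_agree
    (f := fun j k => y (k + -j)) fun j => translate_mem hinv hy (-j)
  obtain ⟨z, hz, B, hzu, hzv⟩ := h.exists_join hinv hu hv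
  obtain ⟨i, hi, hiu⟩ := hux (B + N) (B + N + 1)
  obtain ⟨j, hj, hjv⟩ := hvy (B + N) (B + N)
  have h₁ := (ChainReaches.of_mem hinv hx N 0 (i - (B + N))).congr (x' := x)
    (y' := fun k => z (k + -(B + N))) (fun k _ => by simp) fun k hk => by
      rw [hzu _ (by omega), ← hiu _ (by push_cast; omega) (by push_cast; omega)]
      push_cast [show B + N ≤ i by omega]
      ring_nf
  have h₂ := (ChainReaches.of_mem hinv hz N (-(B + N)) (2 * B + N)).congr
    (x' := fun k => z (k + -(B + N))) (y' := fun k => y (k + (B - j))) (fun k _ => rfl)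
    fun k hk => by
      rw [hzv _ (by push_cast; omega), ← hjv _ (by push_cast; omega) (by push_cast; omega)]
      push_cast
      ring_nf
  have h₃ := (ChainReaches.of_mem hinv hy N (B - j) (j - B)).congr
    (x' := fun k => y (k + (B - j))) (y' := y) (fun k _ => rfl) fun k hk => by
      push_cast [show B ≤ j by omega]
      ring_nf
  exact ⟨_, by omega, (h₁.trans h₂).trans h₃⟩

/-- Two-sided limit shadowing forces chain mixing. -/
theorem ShiftTwoSidedLimitShadowingOn.eventually_chainReaches [TopologicalSpace A]
    [DiscreteTopology A] (h : ShiftTwoSidedLimitShadowingOn X) (hinv : ⇑shiftMap '' X = X)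
    (hX : IsCompact X) (N : ℕ) {x y : ℤ → A} (hx : x ∈ X) (hy : y ∈ X) :
    ∃ L : ℕ, ∀ n ≥ L, ChainReaches X N n x y := by
  obtain ⟨z, hz, B, hzx, hzx'⟩ := h.exists_join hinv hx (translate_mem hinv hx 1)
  set a : ℤ → A := fun k => x (k + -(B + N)) with ha
  have haX : a ∈ X := translate_mem hinv hx _
  have h₁ := ChainReaches.of_mem hinv hx N (-(B + N)) (2 * B + N + 1)
  have h₂ := (ChainReaches.of_mem hinv hz N (-(B + N)) (2 * B + N)).congr (x' := a)
    (y' := fun k => x (k + (-(B + N) + (2 * B + N + 1 : ℕ)))) (fun k hk => hzx _ (by omega))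
    fun k hk => by
      rw [hzx' _ (by push_cast; omega)]
      push_cast
      ring_nf
  obtain ⟨r, -, hr⟩ := h.exists_chainReaches hinv hX N (translate_mem hinv hx _) haX
  have h₀ : ChainReaches X N 0 a a := by
    simpa using ChainReaches.of_mem hinv haX N 0 0
  have hloop := h₀.eventually_loop (h₂.trans hr) (by
    convert h₁.trans hr using 1
    ring)
  obtain ⟨m, -, hm⟩ := h.exists_chainReaches hinv hX N hx haX
  obtain ⟨l, -, hl⟩ := h.exists_chainReaches hinv hX N haX hy
  refine ⟨m + (2 * B + N + r) * (2 * B + N + r) + l, fun n hn => ?_⟩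
  convert (hm.trans (hloop (n - m - l) (by omega))).trans hl using 1
  omega

end LimitShadowing

section FiniteType

variable {A : Type*} {X : Set (ℤ → A)}

/-- Words `w N` with windows of length `N + 1` in `X` which overlap suitably can be concatenated to
a single sequence. -/
theorem HasWindowsIn.exists_concat {w : ℕ → ℕ → A} {l : ℕ → ℕ} (hl : ∀ N, 1 ≤ l N)
    (hw : ∀ N, HasWindowsIn X N (l N) (w N))
    (hglue : ∀ N, ∀ k ≤ N, w N (l N + k) = w (N + 1) k) :
    ∃ (W : ℕ → A) (T : ℕ → ℕ), StrictMono T ∧ (∀ N, ∀ k ≤ l N + N, W (T N + k) = w N k) ∧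
      ∀ M, ∀ i ≥ T M, ∃ p ∈ X, ∀ k : ℕ, k ≤ M → p k = W (i + k) := by
  let T : ℕ → ℕ := fun N => ∑ j ∈ Finset.range N, l j
  have hTs : ∀ N, T (N + 1) = T N + l N := fun N => Finset.sum_range_succ _ _
  have hT : StrictMono T := strictMono_nat_of_lt_succ fun N => by have := hl N; rw [hTs]; omega
  let W : ℕ → A := fun i =>
    w (Nat.findGreatest (fun N => T N ≤ i) i) (i - T (Nat.findGreatest (fun N => T N ≤ i) i))
  have hW₀ : ∀ N, ∀ k < l N, W (T N + k) = w N k := by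
    intro N k hk
    have : Nat.findGreatest (fun N' => T N' ≤ T N + k) (T N + k) = N := by
      refine Nat.findGreatest_eq_iff.2 ⟨(hT.id_le N).trans (Nat.le_add_right _ _),
        fun _ => Nat.le_add_right _ _, fun m hm _ hle => ?_⟩
      have := hT.monotone (show N + 1 ≤ m from hm)
      rw [hTs] at this
      omega
    simp only [W, this, Nat.add_sub_cancel_left]
  have hW : ∀ k N, k ≤ l N + N → W (T N + k) = w N k := by
    intro k
    induction k using Nat.strong_induction_on with
    | _ k ih =>
      intro N hk
      by_cases hkl : k < l N
      · exact hW₀ N k hkl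
      · obtain ⟨k', rfl⟩ := Nat.exists_eq_add_of_le (not_lt.1 hkl)
        have := hl N
        rw [← add_assoc, ← hTs, ih k' (by omega) (N + 1) (by omega), hglue N k' (by omega)]
  refine ⟨W, T, hT, fun N k => hW k N, fun M i hi => ?_⟩
  obtain ⟨N, hN, k, hk, rfl⟩ : ∃ N ≥ M, ∃ k < l N, i = T N + k := by
    induction i, hi using Nat.le_induction with
    | base => exact ⟨M, le_rfl, 0, hl M, rfl⟩
    | succ i _ ih =>
      obtain ⟨N, hN, k, hk, rfl⟩ := ih
      by_cases hk' : k + 1 < l N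
      · exact ⟨N, hN, k + 1, hk', rfl⟩
      · exact ⟨N + 1, by omega, 0, hl _, by rw [hTs]; omega⟩
  obtain ⟨p, hp, hpw⟩ := hw N k hk.le
  exact ⟨p, hp, fun j hj => by rw [hpw j (by omega), add_assoc, hW _ _ (by omega)]⟩

/-- If `X` is not of finite type, then some word that does not occur in `X` has all its short
windows in `X`. -/
theorem exists_hasWindowsIn_of_not_isShiftOfFiniteType [TopologicalSpace A]
    (hinv : ⇑shiftMap '' X = X) (hcl : IsClosed X) (hX : ¬IsShiftOfFiniteType X) (N : ℕ) :
    ∃ (n : ℕ) (w : ℕ → A), HasWindowsIn X N n w ∧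
      ¬∃ y ∈ X, ∀ k : ℕ, k ≤ n + N → y k = w k := by
  obtain ⟨x, hx, hxX⟩ : ∃ x : ℤ → A,
      (∀ j : ℤ, ∃ p ∈ X, ∀ k : Fin (N + 1), p (k : ℕ) = x (j + (k : ℕ))) ∧ x ∉ X := by
    by_contra! hcon
    refine hX ⟨N, {w | ∃ p ∈ X, ∀ k : Fin (N + 1), p (k : ℕ) = w k},
      fun x => ⟨fun hx j => ?_, hcon x⟩⟩
    exact ⟨_, translate_mem hinv hx j, fun k => by rw [add_comm]⟩
  obtain ⟨M, hM⟩ := hcl.isOpen_compl.exists_agree_subset hxX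
  refine ⟨2 * M, fun k => x (k - M), fun i _ => ?_, ?_⟩
  · obtain ⟨p, hp, hpx⟩ := hx (i - M)
    refine ⟨p, hp, fun k hk => ?_⟩
    rw [hpx ⟨k, by omega⟩]
    push_cast
    ring_nf
  · rintro ⟨y, hy, hyx⟩
    refine hM _ (fun k h₁ h₂ => ?_) (translate_mem hinv hy M)
    obtain ⟨j, hj⟩ := Int.eq_ofNat_of_zero_le (show 0 ≤ k + M by omega)
    simp only [hj]
    rw [hyx j (by omega)]
    simp only [← hj, add_sub_cancel_right]

theorem ShiftTwoSidedLimitShadowingOn.isShiftOfFiniteType [DecidableEq A] [TopologicalSpace A]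
    [DiscreteTopology A] (h : ShiftTwoSidedLimitShadowingOn X) (hinv : ⇑shiftMap '' X = X)
    (hne : X.Nonempty) (hX : IsCompact X) : IsShiftOfFiniteType X := by
  by_contra hsft
  choose n v hv hbad using
    exists_hasWindowsIn_of_not_isShiftOfFiniteType hinv hX.isClosed hsft
  choose s hs hsv using fun N => hv N 0 (Nat.zero_le _)
  choose t ht htv using fun N => hv N (n N) le_rfl
  choose m hm c hc hct hcs using fun N => h.exists_chainReaches hinv hX N (ht N) (hs (N + 1))
  choose w hw hwv hwc using fun N =>
    (hv N).glue (hc N) fun k hk => by rw [hct N k hk, htv N k hk]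
  obtain ⟨W, T, hT, hTW, hW⟩ := HasWindowsIn.exists_concat (X := X) (w := w)
    (l := fun N => n N + m N) (fun N => by have := hm N; omega) hw fun N k hk => by
      rw [add_assoc, hwc, hcs N k hk, hsv (N + 1) k (by omega), hwv (N + 1) k (by omega), zero_add]
  obtain ⟨x, hx⟩ := hne
  obtain ⟨y, hy, hyW⟩ := h.exists_eventually_eq ⟨x, hx⟩
    (w := fun i => if i < 0 then x i else W i.toNat) fun M => by
      refine Int.eventually_cofinite_iff.2 ⟨T (2 * M) + M + 1, fun i hi => ?_⟩
      rcases hi with hi | hi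
      · refine ⟨_, translate_mem hinv hx i, fun k h₁ h₂ => ?_⟩
        rw [if_pos (by omega), add_comm]
      · obtain ⟨p, hp, hpW⟩ := hW (2 * M) (i - M).toNat (by omega)
        refine ⟨_, translate_mem hinv hp M, fun k h₁ h₂ => ?_⟩
        rw [if_neg (by omega)]
        obtain ⟨j, hj⟩ := Int.eq_ofNat_of_zero_le (show 0 ≤ k + M by omega)
        simp only [hj]
        rw [hpW j (by omega)]
        congr 1
        omega
  obtain ⟨B, hB⟩ := Int.eventually_cofinite_iff.1 hyW
  have hTB := hT.id_le B
  refine hbad B ⟨_, translate_mem hinv hy (T B), fun k hk => ?_⟩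
  simp only [id] at hTB
  rw [hB _ (.inr (by omega)), if_neg (by omega), ← hwv B k hk, ← hTW B k (by omega)]
  congr 1
  omega

/-- In a shift of finite type, chains with long enough windows are realized by points. -/
theorem IsShiftOfFiniteType.exists_mem_of_chainReaches (h : IsShiftOfFiniteType X) :
    ∃ N₀ : ℕ, ∀ N ≥ N₀, ∀ x ∈ X, ∀ y ∈ X, ∀ n : ℕ, ChainReaches X N n x y →
      ∃ z ∈ X, ∀ k : ℕ, k ≤ N → z k = x k ∧ z (k + n) = y k := by
  obtain ⟨N₀, hN₀⟩ := h.exists_mem_of_agree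
  refine ⟨N₀, ?_⟩
  rintro N hN x hx y hy n ⟨w, hw, hwx, hwy⟩
  let z : ℤ → A := fun i => if i < 0 then x i else if i < n then w i.toNat else y (i - n)
  have hzw : ∀ k : ℕ, k ≤ n + N → z k = w k := by
    intro k hk
    simp only [z]
    rw [if_neg (by omega)]
    split_ifs with hkn
    · simp
    · obtain ⟨j, rfl⟩ := Nat.exists_eq_add_of_le (show n ≤ k by omega)
      rw [hwy j (by omega)]
      congr 1
      omega
  have hzx : ∀ i : ℤ, i ≤ N → z i = x i := by
    intro i hi
    by_cases h₀ : i < 0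
    · exact if_pos h₀
    · lift i to ℕ using not_lt.1 h₀
      rw [hzw i (by omega), hwx i (by omega)]
  have hzy : ∀ i : ℤ, n ≤ i → z i = y (i - n) := by
    intro i hi
    simp only [z]
    rw [if_neg (by omega), if_neg (by omega)]
  refine ⟨z, hN₀ z fun j => ?_, fun k hk => ⟨hzx k (by omega), ?_⟩⟩
  · rcases lt_or_ge j 0 with h₁ | h₁
    · exact ⟨x, hx, j, fun k _ hk => hzx _ (by omega)⟩
    · rcases lt_or_ge (n : ℤ) j with h₂ | h₂
      · refine ⟨y, hy, j - n, fun k hk₀ _ => ?_⟩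
        rw [hzy _ (by omega)]
        ring_nf
      · lift j to ℕ using h₁
        obtain ⟨p, hp, hpw⟩ := hw j (by omega)
        refine ⟨p, hp, 0, fun k hk₀ hk => ?_⟩
        lift k to ℕ using hk₀
        rw [zero_add, hpw k (by omega), ← hzw _ (by omega)]
        push_cast
        rfl
  · rw [hzy _ (by omega), add_sub_cancel_right]

theorem ShiftTwoSidedLimitShadowingOn.shiftMixingOn [DecidableEq A] [TopologicalSpace A]
    [DiscreteTopology A] (h : ShiftTwoSidedLimitShadowingOn X) (hinv : ⇑shiftMap '' X = X)
    (hX : IsCompact X) (hsft : IsShiftOfFiniteType X) : ShiftMixingOn X := by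
  rintro U V hU hV ⟨x, hxU, hx⟩ ⟨y, hyV, hy⟩
  obtain ⟨M₁, hM₁⟩ := hU.exists_agree_subset hxU
  obtain ⟨M₂, hM₂⟩ := hV.exists_agree_subset hyV
  obtain ⟨N₀, hN₀⟩ := hsft.exists_mem_of_chainReaches
  have hx' := translate_mem hinv hx (-(M₁ + M₂))
  have hy' := translate_mem hinv hy (-(M₁ + M₂))
  obtain ⟨L, hL⟩ := h.eventually_chainReaches hinv hX (N₀ + 2 * (M₁ + M₂)) hx' hy'
  refine ⟨L, fun n hn => ?_⟩
  obtain ⟨z, hz, hzxy⟩ := hN₀ _ (by omega) _ hx' _ hy' n (hL n hn)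
  have hz' := translate_mem hinv hz (M₁ + M₂)
  refine ⟨_, ⟨_, ⟨hM₁ _ fun k h₁ h₂ => ?_, hz'⟩, rfl⟩, hM₂ _ fun k h₁ h₂ => ?_, ?_⟩
  · obtain ⟨j, hj⟩ := Int.eq_ofNat_of_zero_le (show 0 ≤ k + (M₁ + M₂) by omega)
    simp only [hj]
    rw [(hzxy j (by omega)).1, ← hj, add_neg_cancel_right]
  · obtain ⟨j, hj⟩ := Int.eq_ofNat_of_zero_le (show 0 ≤ k + (M₁ + M₂) by omega)
    rw [shiftMap_pow_apply]
    simp only [add_right_comm k (n : ℤ), hj]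
    rw [(hzxy j (by omega)).2, ← hj, add_neg_cancel_right]
  · convert translate_mem hinv hz' n using 1
    funext k
    rw [shiftMap_pow_apply]

end FiniteType

/-- A nonempty closed shift-invariant subset `X ⊆ A^ℤ` (for `A` finite and discrete)
is a topologically mixing shift of finite type if and only if the shift restricted to
`X` has the two-sided limit shadowing property. -/
theorem stmt17 {A : Type*} [Fintype A] [Nonempty A] [DecidableEq A]
    [TopologicalSpace A] [DiscreteTopology A]
    (X : Set (ℤ → A)) (hne : X.Nonempty) (hcl : IsClosed X)
    (hinv : ⇑shiftMap '' X = X) :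
    (IsShiftOfFiniteType X ∧ ShiftMixingOn X) ↔
      ShiftTwoSidedLimitShadowingOn X := by
  have hX : IsCompact X := hcl.isCompact
  refine ⟨fun ⟨hsft, hmix⟩ => hsft.twoSidedLimitShadowing hmix, fun h => ?_⟩
  have hsft := h.isShiftOfFiniteType hinv hne hX
  exact ⟨hsft, h.shiftMixingOn hinv hX hsft⟩
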